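/- Judge's uncertainty relation with the optimal constant 1/2: let ψ ∈ L²([-π,π]) be a unit vector with Fourier coefficients ψ̂(n) = (2π)^{-1/2}∫_{-π}^{π} e^{-inθ}ψ(θ)dθ. Define the number variance V_N(ψ) = inf over m ∈ ℤ of ∑_{n∈ℤ}(n−m)²|ψ̂(n)|², and the arc-metric angle variance V_arc(ψ) = inf over α ∈ ℝ of ∫_{-π}^{π} d_arc(θ,α)² |ψ(θ)|² dθ, where d_arc(θ,α) = min_{k∈ℤ}|θ − α − 2πk|. Then √(V_N(ψ)) · √(V_arc(ψ)) ≥ (1/2)·(1 − (3/π²)·V_arc(ψ)). -/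

import Mathlib

open MeasureTheory Real
open scoped ENNReal

section CircleL2

open AddCircle

variable {T : ℝ} [hT : Fact (0 < T)]

lemma intervalIntegral_norm_sq_eq_mul_Lp_norm_sq (f : Lp ℂ 2 (haarAddCircle (T := T)))
    {h : AddCircle T → ℂ} (hh : h =ᵐ[haarAddCircle] f) (a : ℝ) :
    ∫ θ in a..a + T, ‖h θ‖ ^ 2 = T * ‖f‖ ^ 2 := by
  rw [AddCircle.intervalIntegral_preimage T a (fun z ↦ ‖h z‖ ^ 2)]
  have h1 : ∫ t, ‖h t‖ ^ 2 ∂haarAddCircle = ‖f‖ ^ 2 := by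
    have e : ∫ t, ‖h t‖ ^ 2 ∂haarAddCircle = ∫ t, ‖f t‖ ^ 2 ∂haarAddCircle :=
      integral_congr_ae (hh.mono fun x hx ↦ by simp [hx])
    rw [e, ← tsum_sq_fourierCoeff]
    have H₁ : HasSum (fun i => ‖fourierBasis.repr f i‖ ^ 2) (‖fourierBasis.repr f‖ ^ 2) := by
      apply_mod_cast lp.hasSum_norm ?_ (fourierBasis.repr f)
      simp
    simpa only [fourierBasis_repr, LinearIsometryEquiv.norm_map] using H₁.tsum_eq
  rw [← h1, integral_haarAddCircle, smul_eq_mul, mul_inv_cancel_left₀ hT.out.ne']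

lemma coeFn_sum_smul_fourierLp (s : Finset ℤ) (d : ℤ → ℂ) :
    (fun z ↦ ∑ n ∈ s, d n * fourier n z) =ᵐ[haarAddCircle]
      ⇑(∑ n ∈ s, d n • fourierLp (T := T) 2 n) := by
  have e : ∑ n ∈ s, d n • fourierLp (T := T) 2 n =
      ContinuousMap.toLp (E := ℂ) 2 haarAddCircle ℂ (∑ n ∈ s, d n • fourier n) := by
    simp [fourierLp, map_sum]
  rw [e]
  filter_upwards [ContinuousMap.coeFn_toLp (p := 2) (𝕜 := ℂ) haarAddCircle
    (∑ n ∈ s, d n • fourier (T := T) n)] with z hz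
  rw [hz]
  simp [ContinuousMap.sum_apply]

lemma intervalIntegral_norm_sq_sum_fourier (s : Finset ℤ) (d : ℤ → ℂ) (a : ℝ) :
    ∫ θ in a..a + T, ‖∑ n ∈ s, d n * fourier n (θ : AddCircle T)‖ ^ 2
      = T * ∑ n ∈ s, ‖d n‖ ^ 2 := by
  rw [intervalIntegral_norm_sq_eq_mul_Lp_norm_sq _ (coeFn_sum_smul_fourierLp s d) a]
  congr 1
  have h := (orthonormal_fourier (T := T)).inner_sum d d s
  rw [inner_self_eq_norm_sq_to_K] at h
  simp only [RCLike.conj_mul] at h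
  exact_mod_cast h

lemma exists_intervalIntegral_norm_sub_sum_fourier_lt {φ : AddCircle T → ℂ}
    (hφ : MemLp φ 2 haarAddCircle) {δ : ℝ} (hδ : 0 < δ) :
    ∃ s : Finset ℤ, ∀ a : ℝ,
      ∫ θ in a..a + T, ‖φ θ - ∑ n ∈ s, fourierCoeff φ n * fourier n (θ : AddCircle T)‖ ^ 2 < δ := by
  have hs := hasSum_fourier_series_L2 hφ.toLp
  rw [fourierCoeff_congr_ae hφ.coeFn_toLp] at hs
  have ht : Filter.Tendsto (fun s : Finset ℤ ↦
      T * ‖hφ.toLp - ∑ n ∈ s, fourierCoeff φ n • fourierLp 2 n‖ ^ 2) Filter.atTop (nhds 0) := by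
    have := ((tendsto_const_nhds (x := hφ.toLp)).sub hs).norm.pow 2 |>.const_mul T
    simpa using this
  obtain ⟨s, hs⟩ := (ht.eventually_lt_const hδ).exists
  refine ⟨s, fun a ↦ ?_⟩
  rw [← intervalIntegral_norm_sq_eq_mul_Lp_norm_sq _ (h := fun z ↦ φ z - ∑ n ∈ s,
    fourierCoeff φ n * fourier n z) _ a] at hs
  · exact hs
  · filter_upwards [hφ.coeFn_toLp, coeFn_sum_smul_fourierLp s (fourierCoeff φ),
      Lp.coeFn_sub hφ.toLp (∑ n ∈ s, fourierCoeff φ n • fourierLp 2 n)] with z h1 h2 h3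
    rw [h3, Pi.sub_apply, h1, ← h2]

lemma intervalIntegrable_norm_sq {h : AddCircle T → ℂ} (hh : MemLp h 2 haarAddCircle) (a : ℝ) :
    IntervalIntegrable (fun θ : ℝ ↦ ‖h θ‖ ^ 2) volume a (a + T) := by
  rw [intervalIntegrable_iff_integrableOn_Ioc_of_le (by linarith [hT.out])]
  have := (memLp_haarAddCircle_iff.1 hh).comp_measurePreserving (AddCircle.measurePreserving_mk T a)
  exact (memLp_two_iff_integrable_sq_norm this.1).1 this

end CircleL2

/-- Weighted energy bound on a period centred at `α`. It follows from integrating the derivative of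
`g * ‖q‖ ^ 2`, where `g θ = (θ - α) * (1 - (θ - α) ^ 2 / π ^ 2)` vanishes at both endpoints and
satisfies `|g θ| ≤ |θ - α|`, and completing the square `‖q' + c * g * q‖ ^ 2`. -/
lemma integral_weight_mul_norm_sq_le_integral_norm_deriv_sq {q q' : ℝ → ℂ}
    (hq : ∀ x, HasDerivAt q (q' x) x) (hq' : Continuous q') (α c : ℝ) :
    ∫ θ in (α - π)..(α + π),
        (c * (1 - 3 * (θ - α) ^ 2 / π ^ 2) - c ^ 2 * (θ - α) ^ 2) * ‖q θ‖ ^ 2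
      ≤ ∫ θ in (α - π)..(α + π), ‖q' θ‖ ^ 2 := by
  have hqc : Continuous q := continuous_iff_continuousAt.2 fun x ↦ (hq x).continuousAt
  set g : ℝ → ℝ := fun θ ↦ (θ - α) * (1 - (θ - α) ^ 2 / π ^ 2) with hg
  have hgd : ∀ x, HasDerivAt g (1 - 3 * (x - α) ^ 2 / π ^ 2) x := fun x ↦ by
    have h1 : HasDerivAt (fun θ : ℝ ↦ θ - α) 1 x := (hasDerivAt_id x).sub_const α
    have h2 := h1.mul (((h1.pow 2).div_const (π ^ 2)).const_sub 1)
    convert! h2 using 1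
    simp only [Pi.pow_apply]
    ring
  have hgc : Continuous g := continuous_iff_continuousAt.2 fun x ↦ (hgd x).continuousAt
  have hd : ∀ x, HasDerivAt (fun θ ↦ g θ * ‖q θ‖ ^ 2)
      ((1 - 3 * (x - α) ^ 2 / π ^ 2) * ‖q x‖ ^ 2 + g x * (2 * inner ℝ (q x) (q' x))) x :=
    fun x ↦ (hgd x).mul (hq x).norm_sq
  have hdc : Continuous fun x ↦
      (1 - 3 * (x - α) ^ 2 / π ^ 2) * ‖q x‖ ^ 2 + g x * (2 * inner ℝ (q x) (q' x)) := by
    fun_prop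
  have h0 := intervalIntegral.integral_eq_sub_of_hasDerivAt (a := α - π) (b := α + π)
    (fun x _ ↦ hd x) (hdc.intervalIntegrable _ _)
  have hb : g (α + π) * ‖q (α + π)‖ ^ 2 - g (α - π) * ‖q (α - π)‖ ^ 2 = 0 := by
    have := pi_ne_zero
    simp [hg]
  rw [hb] at h0
  have hle : α - π ≤ α + π := by linarith [pi_pos]
  have key := intervalIntegral.integral_mono_on (μ := volume) hle
    (f := fun θ ↦ (c * (1 - 3 * (θ - α) ^ 2 / π ^ 2) - c ^ 2 * (θ - α) ^ 2) * ‖q θ‖ ^ 2)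
    (g := fun θ ↦ ‖q' θ‖ ^ 2 + c * ((1 - 3 * (θ - α) ^ 2 / π ^ 2) * ‖q θ‖ ^ 2
      + g θ * (2 * inner ℝ (q θ) (q' θ))))
    (Continuous.intervalIntegrable (by fun_prop) _ _)
    (Continuous.intervalIntegrable (by fun_prop) _ _) (fun θ hθ ↦ by
      have hin := abs_le.1 (abs_real_inner_le_norm (q θ) (q' θ))
      have hsq : 0 ≤ ‖q' θ + (c * g θ) • q θ‖ ^ 2 := by positivity
      rw [norm_add_sq_real, norm_smul, inner_smul_right, mul_pow, norm_eq_abs, sq_abs,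
        real_inner_comm] at hsq
      have hgle : g θ ^ 2 ≤ (θ - α) ^ 2 := by
        have ht : (θ - α) ^ 2 ≤ π ^ 2 := sq_le_sq' (by linarith [hθ.1]) (by linarith [hθ.2])
        have h1 : (θ - α) ^ 2 / π ^ 2 ≤ 1 := div_le_one_of_le₀ ht (by positivity)
        have h2 : 0 ≤ (θ - α) ^ 2 / π ^ 2 := by positivity
        rw [hg, mul_pow]
        refine mul_le_of_le_one_right (sq_nonneg _) (pow_le_one₀ (by linarith) (by linarith))
      have h3 : c ^ 2 * g θ ^ 2 * ‖q θ‖ ^ 2 ≤ c ^ 2 * (θ - α) ^ 2 * ‖q θ‖ ^ 2 := by gcongr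
      linarith [h3, hsq])
  rw [intervalIntegral.integral_add (Continuous.intervalIntegrable (by fun_prop) _ _)
    (Continuous.intervalIntegrable (by fun_prop) _ _), intervalIntegral.integral_const_mul, h0]
    at key
  simpa using key

local instance fact_two_pi_pos : Fact (0 < 2 * π) := ⟨two_pi_pos⟩

lemma integral_weight_mul_norm_sq_sum_fourier_le (s : Finset ℤ) (d : ℤ → ℂ) (m : ℤ) (α c : ℝ) :
    ∫ θ in (α - π)..(α + π), (c * (1 - 3 * (θ - α) ^ 2 / π ^ 2) - c ^ 2 * (θ - α) ^ 2)
        * ‖∑ n ∈ s, d n * fourier n (θ : AddCircle (2 * π))‖ ^ 2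
      ≤ 2 * π * ∑ n ∈ s, ((n : ℝ) - m) ^ 2 * ‖d n‖ ^ 2 := by
  have hmul (e : ℤ → ℂ) (θ : ℝ) : ‖∑ n ∈ s, e n * fourier n (θ : AddCircle (2 * π))‖
      = ‖∑ n ∈ s, e n * fourier (n - m) (θ : AddCircle (2 * π))‖ := by
    have : ∑ n ∈ s, e n * fourier n (θ : AddCircle (2 * π)) = fourier m (θ : AddCircle (2 * π)) *
        ∑ n ∈ s, e n * fourier (n - m) (θ : AddCircle (2 * π)) := by
      rw [Finset.mul_sum]
      refine Finset.sum_congr rfl fun n _ ↦ ?_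
      rw [mul_left_comm, ← fourier_add, add_sub_cancel]
    rw [this, norm_mul, fourier_apply, Circle.norm_coe, one_mul]
  have hder : ∀ x : ℝ, HasDerivAt
      (fun θ : ℝ ↦ ∑ n ∈ s, d n * fourier (n - m) (θ : AddCircle (2 * π)))
      (∑ n ∈ s, (d n * (Complex.I * (n - m))) * fourier (n - m) (x : AddCircle (2 * π))) x := by
    intro x
    refine HasDerivAt.fun_sum fun n _ ↦ ?_
    convert! (hasDerivAt_fourier (2 * π) (n - m) x).const_mul (d n) using 1
    have : (π : ℂ) ≠ 0 := by exact_mod_cast pi_ne_zero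
    push_cast
    field_simp
  have h := integral_weight_mul_norm_sq_le_integral_norm_deriv_sq hder
    (continuous_finsetSum _ fun n _ ↦ continuous_const.mul
      ((map_continuous (fourier (n - m))).comp (AddCircle.continuous_mk' (2 * π)))) α c
  simp only [← hmul] at h
  have h2 := intervalIntegral_norm_sq_sum_fourier (T := 2 * π) s
    (fun n ↦ d n * (Complex.I * (n - m))) (α - π)
  rw [show α - π + 2 * π = α + π by ring] at h2
  rw [h2] at h
  refine h.trans_eq ?_
  congr 1
  refine Finset.sum_congr rfl fun n _ ↦ ?_
  have : ‖(n : ℂ) - m‖ = |(n : ℝ) - m| := by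
    rw [← norm_eq_abs, ← Complex.norm_real]
    push_cast
    rfl
  rw [norm_mul, norm_mul, Complex.norm_I, one_mul, this, mul_pow, sq_abs, mul_comm]

lemma norm_sq_sub_norm_sq_le {E : Type*} [SeminormedAddCommGroup E] (x y : E) {ε : ℝ}
    (hε : 0 < ε) : |‖x‖ ^ 2 - ‖y‖ ^ 2| ≤ ε * ‖x‖ ^ 2 + (1 + ε⁻¹) * ‖x - y‖ ^ 2 := by
  have h1 := abs_norm_sub_norm_le x y
  have h2 : ‖y‖ ≤ ‖x‖ + ‖x - y‖ := by
    have := abs_le.1 h1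
    linarith
  have h3 : |‖x‖ ^ 2 - ‖y‖ ^ 2| ≤ ‖x - y‖ * (2 * ‖x‖ + ‖x - y‖) := by
    rw [sq_sub_sq, abs_mul, mul_comm, abs_of_nonneg (by positivity : 0 ≤ ‖x‖ + ‖y‖)]
    exact mul_le_mul h1 (by linarith) (by positivity) (norm_nonneg _)
  have h4 : 2 * ‖x‖ * ‖x - y‖ ≤ ε * ‖x‖ ^ 2 + ε⁻¹ * ‖x - y‖ ^ 2 := by
    have h5 : 0 ≤ ε⁻¹ * (ε * ‖x‖ - ‖x - y‖) ^ 2 := by positivity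
    have h6 : ε⁻¹ * (ε * ‖x‖ - ‖x - y‖) ^ 2
        = ε * ‖x‖ ^ 2 + ε⁻¹ * ‖x - y‖ ^ 2 - 2 * ‖x‖ * ‖x - y‖ := by
      field_simp
      ring
    linarith
  linarith

/-- The weighted energy bound extends from trigonometric polynomials to all square integrable
functions by density. -/
lemma integral_weight_mul_norm_sq_le {φ : AddCircle (2 * π) → ℂ}
    (hφ : MemLp φ 2 AddCircle.haarAddCircle) (α c : ℝ) (m : ℤ) {S : ℝ}
    (hS : ∀ s : Finset ℤ, 2 * π * ∑ n ∈ s, ((n : ℝ) - m) ^ 2 * ‖fourierCoeff φ n‖ ^ 2 ≤ S) :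
    ∫ θ in (α - π)..(α + π), (c * (1 - 3 * (θ - α) ^ 2 / π ^ 2) - c ^ 2 * (θ - α) ^ 2)
        * ‖φ θ‖ ^ 2 ≤ S := by
  set w : ℝ → ℝ := fun θ ↦ c * (1 - 3 * (θ - α) ^ 2 / π ^ 2) - c ^ 2 * (θ - α) ^ 2
  have hwc : Continuous w := by fun_prop
  have hle : α - π ≤ α + π := by linarith [pi_pos]
  have hend : α - π + 2 * π = α + π := by ring
  obtain ⟨C, hC⟩ := (isCompact_Icc (a := α - π) (b := α + π)).exists_bound_of_continuousOn
    hwc.continuousOn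
  have hC0 : 0 ≤ C := (norm_nonneg _).trans (hC (α - π) ⟨le_rfl, hle⟩)
  set M := ∫ θ in (α - π)..(α + π), ‖φ θ‖ ^ 2
  have h_integrable {h : AddCircle (2 * π) → ℂ} (hh : MemLp h 2 AddCircle.haarAddCircle) :
      IntervalIntegrable (fun θ : ℝ ↦ ‖h θ‖ ^ 2) volume (α - π) (α + π) :=
    hend ▸ intervalIntegrable_norm_sq hh (α - π)
  have key : ∀ ε > 0, ∫ θ in (α - π)..(α + π), w θ * ‖φ θ‖ ^ 2 ≤ S + C * (ε * M + ε) := by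
    intro ε hε
    have hδ : 0 < (1 + ε⁻¹)⁻¹ * ε := by positivity
    obtain ⟨s, hs⟩ := exists_intervalIntegral_norm_sub_sum_fourier_lt hφ hδ
    have hs := hs (α - π)
    rw [hend] at hs
    set p : AddCircle (2 * π) → ℂ := fun z ↦ ∑ n ∈ s, fourierCoeff φ n * fourier n z
    have hpm : MemLp p 2 AddCircle.haarAddCircle :=
      (memLp_congr_ae (coeFn_sum_smul_fourierLp s (fourierCoeff φ))).2 (Lp.memLp _)
    have hsub := h_integrable (hφ.sub hpm)
    simp only [Pi.sub_apply] at hsub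
    have hwp := (h_integrable hpm).continuousOn_mul hwc.continuousOn
    have hwφ := (h_integrable hφ).continuousOn_mul hwc.continuousOn
    have hI2 := (((h_integrable hφ).const_mul ε).add (hsub.const_mul (1 + ε⁻¹))).const_mul C
    have h1 := intervalIntegral.integral_mono_on hle hwφ (hwp.add hI2) (fun θ hθ ↦ by
      have h3 := norm_sq_sub_norm_sq_le (φ θ) (p θ) hε
      have h4 : w θ * (‖φ θ‖ ^ 2 - ‖p θ‖ ^ 2)
          ≤ C * (ε * ‖φ θ‖ ^ 2 + (1 + ε⁻¹) * ‖φ θ - p θ‖ ^ 2) :=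
        (le_abs_self _).trans <| by
          rw [abs_mul]
          exact mul_le_mul (hC θ hθ) h3 (abs_nonneg _) hC0
      linarith)
    rw [intervalIntegral.integral_add hwp hI2, intervalIntegral.integral_const_mul,
      intervalIntegral.integral_add ((h_integrable hφ).const_mul ε) (hsub.const_mul (1 + ε⁻¹)),
      intervalIntegral.integral_const_mul, intervalIntegral.integral_const_mul] at h1
    have h5 := (integral_weight_mul_norm_sq_sum_fourier_le s (fourierCoeff φ) m α c).trans (hS s)
    have h6 : (1 + ε⁻¹) * ∫ θ in (α - π)..(α + π), ‖φ θ - p θ‖ ^ 2 ≤ ε := by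
      refine (mul_le_mul_of_nonneg_left hs.le (by positivity)).trans_eq ?_
      rw [mul_inv_cancel_left₀ (by positivity)]
    refine h1.trans (add_le_add h5 ?_)
    gcongr
  have hlim : Filter.Tendsto (fun ε : ℝ ↦ S + C * (ε * M + ε)) (nhdsWithin 0 (Set.Ioi 0))
      (nhds S) := by
    have : Continuous fun ε : ℝ ↦ S + C * (ε * M + ε) := by fun_prop
    simpa using (this.tendsto 0).mono_left nhdsWithin_le_nhds
  exact ge_of_tendsto hlim (Filter.eventually_mem_set.2 (Filter.mem_of_superset
    self_mem_nhdsWithin fun ε hε ↦ key ε hε))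

lemma iInf_abs_sub_two_pi_mul (x : ℝ) :
    ⨅ k : ℤ, |x - 2 * π * (k : ℝ)| = ‖(x : AddCircle (2 * π))‖ := by
  have hp : (2 * π) ≠ 0 := two_pi_pos.ne'
  have hb : BddBelow (Set.range fun k : ℤ ↦ |x - 2 * π * (k : ℝ)|) :=
    ⟨0, by rintro _ ⟨k, rfl⟩; exact abs_nonneg _⟩
  refine le_antisymm ?_ (le_ciInf fun k ↦ ?_)
  · rw [AddCircle.norm_eq, mul_comm (round _ : ℝ)]
    exact ciInf_le hb _
  · rw [AddCircle.norm_eq' _ two_pi_pos]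
    calc _ ≤ 2 * π * |(2 * π)⁻¹ * x - k| :=
          mul_le_mul_of_nonneg_left (round_le _ _) two_pi_pos.le
      _ = |2 * π * ((2 * π)⁻¹ * x - k)| := by rw [abs_mul, abs_of_pos two_pi_pos]
      _ = _ := by rw [mul_sub, mul_inv_cancel_left₀ hp]

lemma intervalIntegral_arc_sq_mul_eq (ψ : ℝ → ℂ) (a : ℝ) :
    ∫ θ in (-π)..π, ‖((θ - a : ℝ) : AddCircle (2 * π))‖ ^ 2 * ‖ψ θ‖ ^ 2
      = ∫ θ in (a - π)..(a + π), (θ - a) ^ 2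
          * ‖AddCircle.liftIoc (2 * π) (-π) ψ (θ : AddCircle (2 * π))‖ ^ 2 := by
  set φ := AddCircle.liftIoc (2 * π) (-π) ψ with hφ
  have h1 : ∫ θ in (-π)..π, ‖((θ - a : ℝ) : AddCircle (2 * π))‖ ^ 2 * ‖ψ θ‖ ^ 2
      = ∫ θ in (-π)..(-π + 2 * π), ‖((θ - a : ℝ) : AddCircle (2 * π))‖ ^ 2 * ‖φ θ‖ ^ 2 := by
    rw [show -π + 2 * π = π by ring]
    refine intervalIntegral.integral_congr_ae (ae_of_all _ fun θ hθ ↦ ?_)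
    rw [Set.uIoc_of_le (by linarith [pi_pos])] at hθ
    rw [hφ, AddCircle.liftIoc_coe_apply (by rwa [show -π + 2 * π = π by ring])]
  have hper : Function.Periodic (fun θ : ℝ ↦
      ‖((θ - a : ℝ) : AddCircle (2 * π))‖ ^ 2 * ‖φ θ‖ ^ 2) (2 * π) := fun θ ↦ by
    simp only [AddCircle.coe_add_period, AddCircle.coe_sub]
  rw [h1, hper.intervalIntegral_add_eq (-π) (a - π), show a - π + 2 * π = a + π by ring]
  refine intervalIntegral.integral_congr_ae (ae_of_all _ fun θ hθ ↦ ?_)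
  rw [Set.uIoc_of_le (by linarith [pi_pos])] at hθ
  rw [(AddCircle.norm_coe_eq_abs_iff (2 * π) two_pi_pos.ne').2, sq_abs]
  rw [abs_of_pos two_pi_pos, abs_le]
  constructor <;> linarith [hθ.1, hθ.2]

lemma exists_iInf_eq_intervalIntegral_arc_sq {ρ : ℝ → ℝ}
    (hρ : IntervalIntegrable ρ volume (-π) π) (hρ0 : ∀ θ, 0 ≤ ρ θ) :
    ∃ α : ℝ, ⨅ a : ℝ, ∫ θ in (-π)..π, ‖((θ - a : ℝ) : AddCircle (2 * π))‖ ^ 2 * ρ θ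
      = ∫ θ in (-π)..π, ‖((θ - α : ℝ) : AddCircle (2 * π))‖ ^ 2 * ρ θ := by
  set F : ℝ → ℝ := fun a ↦ ∫ θ in (-π)..π, ‖((θ - a : ℝ) : AddCircle (2 * π))‖ ^ 2 * ρ θ
  have hper : Function.Periodic F (2 * π) := fun a ↦ by
    simp only [F, AddCircle.coe_sub, AddCircle.coe_add_period]
  have hc : Continuous fun x : ℝ ↦ (x : AddCircle (2 * π)) := AddCircle.continuous_mk' _
  have hcont : Continuous F := by
    refine intervalIntegral.continuous_of_dominated_interval (bound := fun θ ↦ π ^ 2 * ρ θ)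
      (fun a ↦ ?_) (fun a ↦ ae_of_all _ fun θ _ ↦ ?_) (hρ.const_mul _)
      (ae_of_all _ fun θ _ ↦ ?_)
    · exact ((hc.comp (continuous_id.sub continuous_const)).norm.pow 2).aestronglyMeasurable.mul
        (Set.uIoc_of_le (by linarith [pi_pos] : -π ≤ π) ▸ hρ.1.aestronglyMeasurable)
    · rw [norm_mul, norm_pow, norm_norm, norm_of_nonneg (hρ0 θ)]
      have := AddCircle.norm_le_half_period (2 * π) (x := ((θ - a : ℝ) : AddCircle (2 * π)))
        two_pi_pos.ne'
      rw [abs_of_pos two_pi_pos, mul_div_cancel_left₀ _ two_ne_zero] at this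
      have := hρ0 θ
      gcongr
    · exact ((hc.comp (continuous_const.sub continuous_id)).norm.pow 2).mul continuous_const
  obtain ⟨α, hα⟩ := (hper.compact_of_continuous two_pi_pos.ne' hcont).sInf_mem
    (Set.range_nonempty F)
  exact ⟨α, hα.symm⟩

lemma integral_sub_sq_mul_pos {ρ : ℝ → ℝ} {a b α : ℝ} (hab : a ≤ b)
    (hρ : IntervalIntegrable ρ volume a b) (hρ0 : ∀ θ, 0 ≤ ρ θ) (hpos : 0 < ∫ θ in a..b, ρ θ) :
    0 < ∫ θ in a..b, (θ - α) ^ 2 * ρ θ := by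
  have hnn : ∀ θ, 0 ≤ (θ - α) ^ 2 * ρ θ := fun θ ↦ mul_nonneg (sq_nonneg _) (hρ0 θ)
  refine (intervalIntegral.integral_nonneg hab fun θ _ ↦ hnn θ).lt_of_ne fun h0 ↦ hpos.ne' ?_
  have h_integrable : IntervalIntegrable (fun θ ↦ (θ - α) ^ 2 * ρ θ) volume a b :=
    hρ.continuousOn_mul (by fun_prop)
  have hz := (intervalIntegral.integral_eq_zero_iff_of_le_of_nonneg_ae hab
    (ae_of_all _ hnn) h_integrable).1 h0.symm
  rw [intervalIntegral.integral_of_le hab]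
  refine integral_eq_zero_of_ae ?_
  have hne : ∀ᵐ θ ∂(volume.restrict (Set.Ioc a b)), θ ≠ α :=
    ae_restrict_of_ae (Measure.ae_ne volume α)
  filter_upwards [hz, hne] with θ h1 h2
  exact (mul_eq_zero.1 h1).resolve_left (pow_ne_zero 2 (sub_ne_zero.2 h2))

/-- **Judge's uncertainty relation** with the optimal constant `1/2`: for every normalized
`ψ ∈ L²([-π,π])`, with `V_N` the number variance (minimized over integer reference points,
possibly infinite) and `V_arc` the arc-metric angle variance,
`√V_N · √V_arc ≥ (1/2)(1 − (3/π²)V_arc)`. -/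
theorem judge_uncertainty_relation
    (ψ : ℝ → ℂ)
    (hmeas : AEStronglyMeasurable ψ (volume.restrict (Set.Ioc (-π) π)))
    (hnorm : (∫ θ in (-π)..π, ‖ψ θ‖ ^ 2) = 1)
    (ψhat : ℤ → ℂ)
    (hψhat : ∀ n : ℤ, ψhat n
      = (Real.sqrt (2 * π) : ℂ)⁻¹ * ∫ θ in (-π)..π, Complex.exp (-(n : ℂ) * θ * Complex.I) * ψ θ)
    (VN : ℝ≥0∞)
    (hVN : VN = ⨅ m : ℤ, ∑' n : ℤ, ENNReal.ofReal (((n : ℝ) - (m : ℝ)) ^ 2 * ‖ψhat n‖ ^ 2))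
    (Varc : ℝ)
    (hVarc : Varc = ⨅ a : ℝ,
      ∫ θ in (-π)..π, (⨅ k : ℤ, |θ - a - 2 * π * (k : ℝ)|) ^ 2 * ‖ψ θ‖ ^ 2) :
    VN ^ (1/2 : ℝ) * ENNReal.ofReal Varc ^ (1/2 : ℝ)
      ≥ ENNReal.ofReal ((1/2) * (1 - 3 / π ^ 2 * Varc)) := by
  have hle : -π ≤ π := by linarith [pi_pos]
  have hend : -π + 2 * π = π := by ring
  have h_integrable : IntervalIntegrable (fun θ ↦ ‖ψ θ‖ ^ 2) volume (-π) π := by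
    by_contra h
    rw [intervalIntegral.integral_undef h] at hnorm
    exact zero_ne_one hnorm
  have hψ : MemLp ψ 2 (volume.restrict (Set.Ioc (-π) π)) :=
    (memLp_two_iff_integrable_sq_norm hmeas).2
      ((intervalIntegrable_iff_integrableOn_Ioc_of_le hle).1 h_integrable)
  set φ := AddCircle.liftIoc (2 * π) (-π) ψ with hφ_def
  have hφ : MemLp φ 2 AddCircle.haarAddCircle := by
    have h : MemLp ψ 2 (volume.restrict (Set.Ioc (-π) (-π + 2 * π))) := by rwa [hend]
    exact h.memLp_liftIoc.haarAddCircle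
  have hcoeff : ∀ n, ‖ψhat n‖ ^ 2 = 2 * π * ‖fourierCoeff φ n‖ ^ 2 := by
    intro n
    have h1 : fourierCoeff φ n = (1 / (2 * π) : ℝ) •
        ∫ θ in (-π)..π, Complex.exp (-(n : ℂ) * θ * Complex.I) * ψ θ := by
      rw [fourierCoeff_eq_intervalIntegral φ n (-π), hend]
      congr 1
      refine intervalIntegral.integral_congr_ae (ae_of_all _ fun θ hθ ↦ ?_)
      rw [Set.uIoc_of_le hle] at hθ
      rw [hφ_def, AddCircle.liftIoc_coe_apply (by rwa [hend]), fourier_coe_apply, smul_eq_mul]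
      congr 2
      have : (π : ℂ) ≠ 0 := by exact_mod_cast pi_ne_zero
      push_cast
      field_simp
    rw [h1, hψhat]
    generalize ∫ θ in (-π)..π, Complex.exp (-(n : ℂ) * θ * Complex.I) * ψ θ = J
    rw [norm_mul, norm_smul, norm_inv, Complex.norm_real, norm_eq_abs, norm_eq_abs,
      mul_pow, mul_pow, inv_pow, sq_abs, sq_abs, sq_sqrt two_pi_pos.le]
    have := pi_pos
    field_simp
  simp only [iInf_abs_sub_two_pi_mul] at hVarc
  obtain ⟨α, hα⟩ := exists_iInf_eq_intervalIntegral_arc_sq h_integrable fun θ ↦ by positivity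
  rw [hα, intervalIntegral_arc_sq_mul_eq, ← hφ_def] at hVarc
  have hshift : α - π + 2 * π = α + π := by ring
  have hφint : IntervalIntegrable (fun θ : ℝ ↦ ‖φ θ‖ ^ 2) volume (α - π) (α + π) :=
    hshift ▸ intervalIntegrable_norm_sq hφ (α - π)
  have hφnorm : ∫ θ in (α - π)..(α + π), ‖φ θ‖ ^ 2 = 1 := by
    rw [← hshift, AddCircle.intervalIntegral_preimage (2 * π) (α - π) (fun z ↦ ‖φ z‖ ^ 2), ← hnorm,
      ← AddCircle.intervalIntegral_preimage (2 * π) (-π) (fun z ↦ ‖φ z‖ ^ 2), hend]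
    refine intervalIntegral.integral_congr_ae (ae_of_all _ fun θ hθ ↦ ?_)
    rw [Set.uIoc_of_le hle] at hθ
    rw [hφ_def, AddCircle.liftIoc_coe_apply (by rwa [hend])]
  have hV : 0 < Varc := by
    rw [hVarc]
    exact integral_sub_sq_mul_pos (by linarith [pi_pos]) hφint (fun _ ↦ by positivity)
      (by rw [hφnorm]; exact one_pos)
  set K := 1 - 3 / π ^ 2 * Varc with hK
  rcases le_or_gt K 0 with hK0 | hK0
  · rw [ENNReal.ofReal_of_nonpos (p := 1 / 2 * K) (by linarith)]
    exact zero_le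
  have hVN_ge : ENNReal.ofReal (K ^ 2 / (4 * Varc)) ≤ VN := by
    rw [hVN]
    refine le_iInf fun m ↦ ?_
    by_cases htop : ∑' n : ℤ, ENNReal.ofReal (((n : ℝ) - (m : ℝ)) ^ 2 * ‖ψhat n‖ ^ 2) = ⊤
    · rw [htop]
      exact le_top
    refine (ENNReal.ofReal_le_iff_le_toReal htop).2 ?_
    have h := integral_weight_mul_norm_sq_le hφ α (K / (2 * Varc)) m fun s ↦ by
      have h2 := ENNReal.toReal_mono htop (ENNReal.sum_le_tsum s)
      rw [ENNReal.toReal_sum fun _ _ ↦ ENNReal.ofReal_ne_top] at h2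
      refine le_trans (le_of_eq ?_) h2
      rw [Finset.mul_sum]
      refine Finset.sum_congr rfl fun n _ ↦ ?_
      rw [ENNReal.toReal_ofReal (by positivity), hcoeff, mul_left_comm]
    refine le_trans (le_of_eq ?_) h
    set c := K / (2 * Varc) with hc
    have h3 : ∀ θ : ℝ, (c * (1 - 3 * (θ - α) ^ 2 / π ^ 2) - c ^ 2 * (θ - α) ^ 2) * ‖φ θ‖ ^ 2
        = c * ‖φ θ‖ ^ 2 - (3 * c / π ^ 2 + c ^ 2) * ((θ - α) ^ 2 * ‖φ θ‖ ^ 2) := fun θ ↦ by ring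
    simp only [h3]
    rw [intervalIntegral.integral_sub (hφint.const_mul _)
      ((hφint.continuousOn_mul (by fun_prop)).const_mul _), intervalIntegral.integral_const_mul,
      intervalIntegral.integral_const_mul, hφnorm, ← hVarc]
    have h4 : c * 1 - (3 * c / π ^ 2 + c ^ 2) * Varc = c * K - c ^ 2 * Varc := by
      rw [hK]
      ring
    rw [h4, hc]
    field_simp
    ring
  calc ENNReal.ofReal (1 / 2 * K)
      = ENNReal.ofReal ((K / 2) ^ 2) ^ (1 / 2 : ℝ) := by
        rw [ENNReal.ofReal_rpow_of_nonneg (by positivity) (by norm_num), ← sqrt_eq_rpow,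
          sqrt_sq (by positivity)]
        congr 1
        ring
    _ = (ENNReal.ofReal (K ^ 2 / (4 * Varc)) * ENNReal.ofReal Varc) ^ (1 / 2 : ℝ) := by
        rw [← ENNReal.ofReal_mul (by positivity)]
        congr 2
        field_simp
        ring
    _ ≤ (VN * ENNReal.ofReal Varc) ^ (1 / 2 : ℝ) := by gcongr
    _ = _ := ENNReal.mul_rpow_of_nonneg _ _ (by norm_num)
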